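/- arXiv:1102.1278 — 3 statements merged into one kernel-verified Lean document; each statement's English description precedes it below -/
import Mathlib

section
/- Let K be a field and let V ⊂ P³ be the Cayley cubic surface defined by the equation xyz + xyw + xzw + yzw = 0. For a non-singular point p = (x₀:y₀:z₀:w₀) ∈ V(K), either no coordinate vanishes or exactly two of them; put s(p) := x₀y₀z₀w₀ if all four coordinates are nonzero, and s(p) := − (product of the nonzero coordinates) otherwise. Then for any line l ⊂ P³ not contained in V whose three intersection points p₁, p₂, p₃ with V (counted with multiplicity) are all non-singular and K-rational, the product s(p₁)s(p₂)s(p₃) is a perfect square in K. -/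
open MvPolynomial

/-- The Cayley cubic form `xyz + xyw + xzw + yzw`, over any commutative ring. -/
def cayleyF {R : Type*} [CommRing R] (p : Fin 4 → R) : R :=
  p 0 * p 1 * p 2 + p 0 * p 1 * p 3 + p 0 * p 2 * p 3 + p 1 * p 2 * p 3

/-- The gradient of the Cayley cubic form. -/
def cayleyGrad {R : Type*} [CommRing R] (p : Fin 4 → R) : Fin 4 → R :=
  ![p 1 * p 2 + p 1 * p 3 + p 2 * p 3,
    p 0 * p 2 + p 0 * p 3 + p 2 * p 3,
    p 0 * p 1 + p 0 * p 3 + p 1 * p 3,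
    p 0 * p 1 + p 0 * p 2 + p 1 * p 2]

open Classical in
/-- The function `s`: the product of all coordinates if none vanishes, and minus the
product of the nonzero coordinates otherwise. -/
noncomputable def cayleyS {K : Type*} [Field K] (p : Fin 4 → K) : K :=
  if ∀ i, p i ≠ 0 then p 0 * p 1 * p 2 * p 3
  else - ∏ i, (if p i = 0 then 1 else p i)


/-- On the surface and not a vertex. -/
def CNs {K : Type*} [Field K] (p : Fin 4 → K) : Prop :=
  cayleyF p = 0 ∧ ∀ i, ∃ j, j ≠ i ∧ p j ≠ 0

def CGood {K : Type*} [Field K] (p : Fin 3 → Fin 4 → K) : Prop :=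
  ∃ (a b : Fin 4 → K) (c : K) (s t : Fin 3 → K), c ≠ 0 ∧
    (∀ i, p i = s i • a + t i • b) ∧
    (∀ X Y : K, cayleyF (X • a + Y • b) = c * ∏ i, (t i * X - s i * Y)) ∧
    ∀ i, CNs (p i)

def CSq {K : Type*} [Field K] (p : Fin 3 → Fin 4 → K) : Prop :=
  ∃ r : K, cayleyS (p 0) * cayleyS (p 1) * cayleyS (p 2) = r ^ 2

theorem cF_perm {K : Type*} [Field K] (p : Fin 4 → K) (σ : Equiv.Perm (Fin 4)) :
    cayleyF (fun j => p (σ j)) = cayleyF p := by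
  have key : ∀ q : Fin 4 → K, cayleyF q = ∑ i, ∏ j, (if j = i then 1 else q j) := by
    intro q
    simp [cayleyF, Fin.sum_univ_four, Fin.prod_univ_four]
    ring
  rw [key, key, ← Equiv.sum_comp σ (fun i => ∏ j, (if j = i then 1 else p j))]
  refine Finset.sum_congr rfl fun i _ => ?_
  rw [← Equiv.prod_comp σ (fun j => if j = σ i then 1 else p j)]
  simp

theorem cS_perm {K : Type*} [Field K] (p : Fin 4 → K) (σ : Equiv.Perm (Fin 4)) :
    cayleyS (fun j => p (σ j)) = cayleyS p := by
  classical
  have h1 : (∀ i, p (σ i) ≠ 0) ↔ (∀ i, p i ≠ 0) :=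
    ⟨fun h i => by simpa using h (σ.symm i), fun h i => h _⟩
  have h2 : p (σ 0) * p (σ 1) * p (σ 2) * p (σ 3) = p 0 * p 1 * p 2 * p 3 := by
    have := Equiv.prod_comp σ p
    simpa [Fin.prod_univ_four] using this
  have h3 := Equiv.prod_comp σ (fun i => if p i = 0 then 1 else p i)
  unfold cayleyS
  simp only [h1, h2]
  rw [← h3]

theorem cN_perm {K : Type*} [Field K] {p : Fin 4 → K} (h : CNs p) (σ : Equiv.Perm (Fin 4)) :
    CNs (fun j => p (σ j)) := by
  refine ⟨by rw [cF_perm]; exact h.1, fun i => ?_⟩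
  obtain ⟨j, hj, hj'⟩ := h.2 (σ i)
  refine ⟨σ.symm j, ?_, by simpa using hj'⟩
  rintro rfl
  simp at hj

theorem CGood.perm {K : Type*} [Field K] {p : Fin 3 → Fin 4 → K} (h : CGood p)
    (τ : Equiv.Perm (Fin 3)) (σ : Equiv.Perm (Fin 4)) :
    CGood (fun i j => p (τ i) (σ j)) := by
  obtain ⟨a, b, c, s, t, hc, hp, hF, hN⟩ := h
  refine ⟨fun j => a (σ j), fun j => b (σ j), c, fun i => s (τ i), fun i => t (τ i), hc, ?_, ?_, ?_⟩
  · intro i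
    funext j
    simp [hp]
  · intro X Y
    have := cF_perm (X • a + Y • b) σ
    rw [hF, ← Equiv.prod_comp τ] at this
    exact this
  · intro i
    exact cN_perm (hN _) σ

theorem CSq.of_perm {K : Type*} [Field K] {p : Fin 3 → Fin 4 → K}
    (τ : Equiv.Perm (Fin 3)) (σ : Equiv.Perm (Fin 4))
    (h : CSq (fun i j => p (τ i) (σ j))) : CSq p := by
  obtain ⟨r, hr⟩ := h
  refine ⟨r, ?_⟩
  rw [← hr]
  simp only [cS_perm]
  have := Equiv.prod_comp τ (fun i => cayleyS (p i))
  simpa [Fin.prod_univ_three] using this.symm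

theorem cN_cases {K : Type*} [Field K] {p : Fin 4 → K} (h : CNs p) :
    (p 0 ≠ 0 ∧ p 1 ≠ 0 ∧ p 2 ≠ 0 ∧ p 3 ≠ 0) ∨
    (p 0 = 0 ∧ p 1 = 0 ∧ p 2 ≠ 0 ∧ p 3 ≠ 0) ∨
    (p 0 = 0 ∧ p 1 ≠ 0 ∧ p 2 = 0 ∧ p 3 ≠ 0) ∨
    (p 0 = 0 ∧ p 1 ≠ 0 ∧ p 2 ≠ 0 ∧ p 3 = 0) ∨
    (p 0 ≠ 0 ∧ p 1 = 0 ∧ p 2 = 0 ∧ p 3 ≠ 0) ∨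
    (p 0 ≠ 0 ∧ p 1 = 0 ∧ p 2 ≠ 0 ∧ p 3 = 0) ∨
    (p 0 ≠ 0 ∧ p 1 ≠ 0 ∧ p 2 = 0 ∧ p 3 = 0) := by
  obtain ⟨h, h'⟩ := h
  have h0 := h' 0
  have h1 := h' 1
  have h2 := h' 2
  have h3 := h' 3
  simp only [Fin.exists_fin_succ, Fin.exists_fin_zero] at h0 h1 h2 h3
  unfold cayleyF at h
  by_cases e0 : p 0 = 0 <;> by_cases e1 : p 1 = 0 <;> by_cases e2 : p 2 = 0 <;>
    by_cases e3 : p 3 = 0 <;> simp_all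

theorem cN_of_smooth {K : Type*} [Field K] {p : Fin 4 → K} (h : cayleyF p = 0)
    (hs : cayleyGrad p ≠ 0) : CNs p := by
  refine ⟨h, fun i => ?_⟩
  by_contra hcon
  push Not at hcon
  apply hs
  funext k
  fin_cases i
  · have := hcon 1; have := hcon 2; have := hcon 3
    fin_cases k <;> simp_all [cayleyGrad]
  · have := hcon 0; have := hcon 2; have := hcon 3
    fin_cases k <;> simp_all [cayleyGrad]
  · have := hcon 0; have := hcon 1; have := hcon 3
    fin_cases k <;> simp_all [cayleyGrad]
  · have := hcon 0; have := hcon 1; have := hcon 2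
    fin_cases k <;> simp_all [cayleyGrad]

/-- explicit values of s -/
theorem cS_val {K : Type*} [Field K] {p : Fin 4 → K} :
    ((p 0 ≠ 0 ∧ p 1 ≠ 0 ∧ p 2 ≠ 0 ∧ p 3 ≠ 0) → cayleyS p = p 0 * p 1 * p 2 * p 3) ∧
    ((p 0 = 0 ∧ p 1 = 0 ∧ p 2 ≠ 0 ∧ p 3 ≠ 0) → cayleyS p = -(p 2 * p 3)) ∧
    ((p 0 = 0 ∧ p 1 ≠ 0 ∧ p 2 = 0 ∧ p 3 ≠ 0) → cayleyS p = -(p 1 * p 3)) ∧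
    ((p 0 = 0 ∧ p 1 ≠ 0 ∧ p 2 ≠ 0 ∧ p 3 = 0) → cayleyS p = -(p 1 * p 2)) ∧
    ((p 0 ≠ 0 ∧ p 1 = 0 ∧ p 2 = 0 ∧ p 3 ≠ 0) → cayleyS p = -(p 0 * p 3)) ∧
    ((p 0 ≠ 0 ∧ p 1 = 0 ∧ p 2 ≠ 0 ∧ p 3 = 0) → cayleyS p = -(p 0 * p 2)) ∧
    ((p 0 ≠ 0 ∧ p 1 ≠ 0 ∧ p 2 = 0 ∧ p 3 = 0) → cayleyS p = -(p 0 * p 1)) := by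
  refine ⟨?_, ?_, ?_, ?_, ?_, ?_, ?_⟩ <;> rintro ⟨h0, h1, h2, h3⟩ <;>
    simp [cayleyS, Fin.forall_fin_succ, Fin.prod_univ_four, h0, h1, h2, h3]

/-- s agrees with -(x+y)(z+w) up to squares where the latter does not vanish -/
theorem cS_q {K : Type*} [Field K] {p : Fin 4 → K} (h : CNs p)
    (hq : (p 0 + p 1) * (p 2 + p 3) ≠ 0) :
    ∃ r, cayleyS p = -((p 0 + p 1) * (p 2 + p 3)) * r ^ 2 := by
  obtain ⟨v1, v2, v3, v4, v5, v6, v7⟩ := cS_val (p := p)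
  rcases cN_cases h with c | c | c | c | c | c | c
  · rw [v1 c]
    have hn : p 0 + p 1 ≠ 0 := left_ne_zero_of_mul hq
    refine ⟨p 0 * p 1 / (p 0 + p 1), ?_⟩
    have := h.1
    unfold cayleyF at this
    field_simp
    linear_combination p 0 * p 1 * this
  · simp [c] at hq
  · rw [v3 c]; exact ⟨1, by simp [c]⟩
  · rw [v4 c]; exact ⟨1, by simp [c]⟩
  · rw [v5 c]; exact ⟨1, by simp [c]⟩
  · rw [v6 c]; exact ⟨1, by simp [c]⟩
  · simp [c] at hq

theorem c_core {K : Type*} [Field K] {p : Fin 3 → Fin 4 → K} (h : CGood p)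
    (hq : ∀ i, (p i 0 + p i 1) * (p i 2 + p i 3) ≠ 0) : CSq p := by
  choose r hr using fun i => cS_q (by obtain ⟨a, b, c, s, t, hc, hp, hF, hN⟩ := h; exact hN i) (hq i)
  obtain ⟨a, b, c, s, t, hc, hp, hF, hN⟩ := h
  have e1 := hF (b 0 + b 1) (-(a 0 + a 1))
  have e2 := hF (b 2 + b 3) (-(a 2 + a 3))
  refine ⟨r 0 * r 1 * r 2 / c * ((b 0 + b 1) * a 0 - (a 0 + a 1) * b 0) *
    ((b 2 + b 3) * a 2 - (a 2 + a 3) * b 2) *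
    ((b 0 + b 1) * (a 2 + a 3) - (a 0 + a 1) * (b 2 + b 3)), ?_⟩
  have m1 : c * ((p 0 0 + p 0 1) * (p 1 0 + p 1 1) * (p 2 0 + p 2 1)) =
      - ((b 0 + b 1) * a 0 - (a 0 + a 1) * b 0) ^ 2 *
       ((b 0 + b 1) * (a 2 + a 3) - (a 0 + a 1) * (b 2 + b 3)) := by
    simp only [hp, Pi.add_apply, Pi.smul_apply, smul_eq_mul, cayleyF, Fin.prod_univ_three] at e1 ⊢
    linear_combination -e1
  have m2 : c * ((p 0 2 + p 0 3) * (p 1 2 + p 1 3) * (p 2 2 + p 2 3)) =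
      ((b 2 + b 3) * a 2 - (a 2 + a 3) * b 2) ^ 2 *
       ((b 0 + b 1) * (a 2 + a 3) - (a 0 + a 1) * (b 2 + b 3)) := by
    simp only [hp, Pi.add_apply, Pi.smul_apply, smul_eq_mul, cayleyF, Fin.prod_univ_three] at e2 ⊢
    linear_combination -e2
  rw [hr 0, hr 1, hr 2]
  field_simp
  have m3 := congrArg₂ (· * ·) m1 m2
  linear_combination -(r 0 * r 1 * r 2) ^ 2 * m3

theorem c_alg {K : Type*} [Field K] {c u v w x y z P Q R S : K} (hc : c ≠ 0)
    (k0 : c * P = u * v * w) (k1 : c * Q = -u * x * y) (k2 : c * R = v * x * z)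
    (k3 : c * S = -w * y * z) : P * Q * R * S = (u * v * w * x * y * z / c ^ 2) ^ 2 := by
  have m : (c * P) * (c * Q) * ((c * R) * (c * S)) = (u * v * w * x * y * z) ^ 2 := by
    rw [k0, k1, k2, k3]; ring
  rw [div_pow, ← m, eq_div_iff (pow_ne_zero _ (pow_ne_zero _ hc))]
  ring

theorem c_generic {K : Type*} [Field K] {p : Fin 3 → Fin 4 → K} (h : CGood p)
    (hq : ∀ i, p i 0 ≠ 0 ∧ p i 1 ≠ 0 ∧ p i 2 ≠ 0 ∧ p i 3 ≠ 0) : CSq p := by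
  obtain ⟨a, b, c, s, t, hc, hp, hF, hN⟩ := h
  unfold CSq
  rw [cS_val.1 (hq 0), cS_val.1 (hq 1), cS_val.1 (hq 2)]
  have key : ∀ j, c * (p 0 j * p 1 j * p 2 j) = cayleyF (b j • a + (-a j) • b) := by
    intro j
    rw [hF]
    simp only [hp, Pi.add_apply, Pi.smul_apply, smul_eq_mul, Fin.prod_univ_three]
    ring
  have k0 : c * (p 0 0 * p 1 0 * p 2 0) = (b 0 * a 1 - a 0 * b 1) * (b 0 * a 2 - a 0 * b 2) * (b 0 * a 3 - a 0 * b 3) := by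
    rw [key]; simp [cayleyF]; ring
  have k1 : c * (p 0 1 * p 1 1 * p 2 1) = - (b 0 * a 1 - a 0 * b 1) * (b 1 * a 2 - a 1 * b 2) * (b 1 * a 3 - a 1 * b 3) := by
    rw [key]; simp [cayleyF]; ring
  have k2 : c * (p 0 2 * p 1 2 * p 2 2) = (b 0 * a 2 - a 0 * b 2) * (b 1 * a 2 - a 1 * b 2) * (b 2 * a 3 - a 2 * b 3) := by
    rw [key]; simp [cayleyF]; ring
  have k3 : c * (p 0 3 * p 1 3 * p 2 3) = - (b 0 * a 3 - a 0 * b 3) * (b 1 * a 3 - a 1 * b 3) * (b 2 * a 3 - a 2 * b 3) := by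
    rw [key]; simp [cayleyF]; ring
  exact ⟨_, by rw [← c_alg hc k0 k1 k2 k3]; ring⟩

/-- reparametrise by the first two points -/
theorem c_repar {K : Type*} [Field K] {p : Fin 3 → Fin 4 → K} (h : CGood p)
    (h0 : p 0 0 = 0 ∧ p 0 1 = 0 ∧ p 0 2 ≠ 0 ∧ p 0 3 ≠ 0) (h1 : p 1 0 ≠ 0 ∨ p 1 1 ≠ 0) :
    ∃ α β c : K, c ≠ 0 ∧ (∀ j, p 2 j = α * p 0 j + β * p 1 j) ∧
      ∀ X Y, cayleyF (X • p 0 + Y • p 1) = c * X * Y * (β * X - α * Y) := by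
  obtain ⟨a, b, c, s, t, hc, hp, hF, hN⟩ := h
  have hd : s 0 * t 1 - s 1 * t 0 ≠ 0 := by
    intro hd
    have u : ∀ j, s 0 * p 1 j = s 1 * p 0 j := by
      intro j
      simp only [hp, Pi.add_apply, Pi.smul_apply, smul_eq_mul]
      linear_combination b j * hd
    have v : ∀ j, t 0 * p 1 j = t 1 * p 0 j := by
      intro j
      simp only [hp, Pi.add_apply, Pi.smul_apply, smul_eq_mul]
      linear_combination - a j * hd
    have hs : s 0 = 0 ∧ t 0 = 0 := by
      rcases h1 with h1 | h1
      · have u0 := u 0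
        have v0 := v 0
        rw [h0.1, mul_zero] at u0 v0
        exact ⟨(mul_eq_zero.1 u0).resolve_right h1, (mul_eq_zero.1 v0).resolve_right h1⟩
      · have u0 := u 1
        have v0 := v 1
        rw [h0.2.1, mul_zero] at u0 v0
        exact ⟨(mul_eq_zero.1 u0).resolve_right h1, (mul_eq_zero.1 v0).resolve_right h1⟩
    apply h0.2.2.1
    rw [hp 0]
    simp [hs]
  refine ⟨(s 2 * t 1 - s 1 * t 2) / (s 0 * t 1 - s 1 * t 0),
    (s 0 * t 2 - s 2 * t 0) / (s 0 * t 1 - s 1 * t 0),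
    - c * (s 0 * t 1 - s 1 * t 0) ^ 3, ?_, ?_, ?_⟩
  · exact mul_ne_zero (neg_ne_zero.2 hc) (pow_ne_zero _ hd)
  · intro j
    rw [div_mul_eq_mul_div, div_mul_eq_mul_div, ← add_div, eq_div_iff hd]
    simp only [hp, Pi.add_apply, Pi.smul_apply, smul_eq_mul]
    ring
  · intro X Y
    have : X • p 0 + Y • p 1 = (X * s 0 + Y * s 1) • a + (X * t 0 + Y * t 1) • b := by
      funext j
      simp only [hp, Pi.add_apply, Pi.smul_apply, smul_eq_mul]
      ring
    rw [this, hF, Fin.prod_univ_three]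
    field_simp
    ring

theorem CGood.N {K : Type*} [Field K] {p : Fin 3 → Fin 4 → K} (h : CGood p) (i) : CNs (p i) := by
  obtain ⟨a, b, c, s, t, hc, hp, hF, hN⟩ := h; exact hN i

/-- points with x+z = y+w = 0 -/
theorem c_M {K : Type*} [Field K] {p : Fin 4 → K} (h : CNs p)
    (h1 : p 2 = - p 0) (h2 : p 3 = - p 1) : ∃ r, cayleyS p = r ^ 2 := by
  obtain ⟨v1, v2, v3, v4, v5, v6, v7⟩ := cS_val (p := p)
  rcases cN_cases h with c | c | c | c | c | c | c
  · exact ⟨p 0 * p 1, by rw [v1 c, h1, h2]; ring⟩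
  · simp_all
  · exact ⟨p 1, by rw [v3 c, h2]; ring⟩
  · simp_all
  · simp_all
  · exact ⟨p 0, by rw [v6 c, h1]; ring⟩
  · simp_all

theorem c_M' {K : Type*} [Field K] {p : Fin 4 → K} (h : CNs p)
    (h1 : p 3 = - p 0) (h2 : p 2 = - p 1) : ∃ r, cayleyS p = r ^ 2 := by
  rw [← cS_perm p (Equiv.swap 2 3)]
  exact c_M (cN_perm h _) (by simpa [Equiv.swap_apply_def] using h1) (by simpa [Equiv.swap_apply_def] using h2)

/-- classification of bad points -/
theorem c_bad {K : Type*} [Field K] {p : Fin 4 → K} (h : CNs p)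
    (hq : (p 0 + p 2) * (p 1 + p 3) = 0) :
    (p 0 = 0 ∧ p 1 ≠ 0 ∧ p 2 = 0 ∧ p 3 ≠ 0) ∨ (p 0 ≠ 0 ∧ p 1 = 0 ∧ p 2 ≠ 0 ∧ p 3 = 0) ∨
    (p 2 = - p 0 ∧ p 3 = - p 1) := by
  have hf := h.1
  unfold cayleyF at hf
  rcases cN_cases h with c | c | c | c | c | c | c
  · right; right
    obtain ⟨c0, c1, c2, c3⟩ := c
    rcases mul_eq_zero.1 hq with e | e
    · refine ⟨by linear_combination e, ?_⟩
      have : p 0 * p 2 * (p 1 + p 3) = 0 := by linear_combination hf - p 1 * p 3 * e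
      have := (mul_eq_zero.1 this).resolve_left (mul_ne_zero c0 c2)
      linear_combination this
    · refine ⟨?_, by linear_combination e⟩
      have : p 1 * p 3 * (p 0 + p 2) = 0 := by linear_combination hf - p 0 * p 2 * e
      have := (mul_eq_zero.1 this).resolve_left (mul_ne_zero c1 c3)
      linear_combination this
  all_goals simp_all

/-- first two points (0,0,z,w), (x,x,-x,-x) -/
theorem c_caseC {K : Type*} [Field K] {p : Fin 3 → Fin 4 → K} (h : CGood p)
    (h0 : p 0 0 = 0 ∧ p 0 1 = 0 ∧ p 0 2 ≠ 0 ∧ p 0 3 ≠ 0)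
    (h1 : p 1 1 = p 1 0 ∧ p 1 2 = - p 1 0 ∧ p 1 3 = - p 1 0) : CSq p := by
  have hx : p 1 0 ≠ 0 := by
    intro hx
    rcases cN_cases (h.N 1) with c | c | c | c | c | c | c <;> simp_all
  obtain ⟨α, β, c, hc, h2, hF⟩ := c_repar h h0 (Or.inl hx)
  obtain ⟨r1, hr1⟩ := c_M (h.N 1) h1.2.1 (by rw [h1.2.2, h1.1])
  unfold CSq
  rw [hr1, cS_val.2.1 h0]
  have f1 := hF (p 1 0) (p 0 2)
  have f2 := hF (p 1 0) (p 0 3)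
  obtain ⟨a0, a1, a2, a3⟩ := h0
  obtain ⟨b1, b2, b3⟩ := h1
  have e0 := h2 0
  have e1 := h2 1
  have e2 := h2 2
  have e3 := h2 3
  simp only [cayleyF, Pi.add_apply, Pi.smul_apply, smul_eq_mul, a0, a1, b1, b2, b3] at f1 f2 e0 e1 e2 e3
  have g1 : c * p 2 2 = - p 0 2 * (p 1 0) ^ 2 * (p 0 3 - p 0 2) := by
    apply mul_left_cancel₀ (mul_ne_zero hx a2)
    rw [e2]; linear_combination f1
  have g2 : c * p 2 3 = - p 0 3 * (p 1 0) ^ 2 * (p 0 2 - p 0 3) := by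
    apply mul_left_cancel₀ (mul_ne_zero hx a3)
    rw [e3]; linear_combination f2
  have h21 : p 2 1 = p 2 0 := by rw [e0, e1]
  obtain ⟨v1, v2, v3, v4, v5, v6, v7⟩ := cS_val (p := p 2)
  rcases cN_cases (h.N 2) with k | k | k | k | k | k | k
  · rw [v1 k]
    refine ⟨r1 * p 2 0 * p 0 2 * p 0 3 * (p 1 0) ^ 2 * (p 0 2 - p 0 3) / c, ?_⟩
    have g3 := congrArg₂ (· * ·) g1 g2
    have : p 2 1 = p 2 0 := by rw [e0, e1]
    rw [this]
    field_simp
    linear_combination - (r1 * p 2 0) ^ 2 * g3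
  · rw [v2 k]
    have hb : β = 0 := by
      have := k.1
      rw [e0] at this
      simpa [hx] using this
    rw [e2, e3, hb]
    exact ⟨r1 * α * p 0 2 * p 0 3, by ring⟩
  · exact absurd (h21.trans k.1) k.2.1
  · exact absurd (h21.trans k.1) k.2.1
  · exact absurd (h21.symm.trans k.2.1) k.1
  · exact absurd (h21.symm.trans k.2.1) k.1
  · rw [v7 k]
    have hzw : p 0 3 = p 0 2 := by
      have g := g1
      rw [k.2.2.1] at g
      have : p 0 2 * (p 1 0) ^ 2 * (p 0 3 - p 0 2) = 0 := by linear_combination g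
      have := (mul_eq_zero.1 this).resolve_left (mul_ne_zero a2 (pow_ne_zero _ hx))
      linear_combination this
    have : p 2 1 = p 2 0 := by rw [e0, e1]
    rw [hzw, this]
    exact ⟨r1 * p 0 2 * p 2 0, by ring⟩

/-- plane case -/
theorem c_plane {K : Type*} [Field K] {p : Fin 3 → Fin 4 → K} (h : CGood p)
    (h0 : p 0 0 = 0 ∧ p 0 1 = 0 ∧ p 0 2 ≠ 0 ∧ p 0 3 ≠ 0)
    (h1 : p 1 0 = 0 ∧ p 1 1 ≠ 0 ∧ p 1 2 = 0 ∧ p 1 3 ≠ 0)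
    (hq : (p 2 0 + p 2 3) * (p 2 1 + p 2 2) = 0) : CSq p := by
  obtain ⟨α, β, c, hc, h2, hF⟩ := c_repar h h0 (Or.inr h1.2.1)
  have e0 := h2 0
  have e1 := h2 1
  have e2 := h2 2
  have e3 := h2 3
  unfold CSq
  rw [cS_val.2.1 h0, cS_val.2.2.1 h1]
  obtain ⟨a0, a1, a2, a3⟩ := h0
  obtain ⟨b0, b1, b2, b3⟩ := h1
  simp only [a0, a1, b0, b2, mul_zero, zero_add, add_zero] at e0 e1 e2 e3
  obtain ⟨v1, v2, v3, v4, v5, v6, v7⟩ := cS_val (p := p 2)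
  rcases cN_cases (h.N 2) with k | k | k | k | k | k | k
  · exact absurd e0 k.1
  · exfalso; simp [k] at hq
  · exfalso; simp [k] at hq
  · rw [v4 k]
    have := k.2.2.2
    rw [e3] at this
    rw [e1, e2]
    exact ⟨p 0 2 * p 1 1 * (β * p 1 3), by
      linear_combination (-(p 0 2 * p 1 1) ^ 2 * (β * p 1 3)) * this⟩
  all_goals exact absurd e0 k.1

/-- main degenerate case -/
theorem c_finish {K : Type*} [Field K] {p : Fin 3 → Fin 4 → K} (h : CGood p)
    (h0 : p 0 0 = 0 ∧ p 0 1 = 0 ∧ p 0 2 ≠ 0 ∧ p 0 3 ≠ 0)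
    (hq1 : (p 1 0 + p 1 2) * (p 1 1 + p 1 3) = 0)
    (hq2 : (p 2 0 + p 2 3) * (p 2 1 + p 2 2) = 0) : CSq p := by
  rcases c_bad (h.N 1) hq1 with k | k | k
  · exact c_plane h h0 k hq2
  · refine CSq.of_perm 1 (Equiv.swap 0 1 * Equiv.swap 2 3) (c_plane (h.perm _ _) ?_ ?_ ?_) <;>
      simp [Equiv.swap_apply_def, h0, k]
    simp at hq2
    tauto
  have hb := c_bad (cN_perm (h.N 2) (Equiv.swap 2 3)) (by simpa [Equiv.swap_apply_def] using hq2)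
  simp [Equiv.swap_apply_def] at hb
  rcases hb with l | l | l
  · refine CSq.of_perm (Equiv.swap 1 2) (Equiv.swap 2 3) (c_plane (h.perm _ _) ?_ ?_ ?_) <;>
      simp [Equiv.swap_apply_def, h0, k, l]
  · refine CSq.of_perm (Equiv.swap 1 2) (Equiv.swap 0 1 * Equiv.swap 2 3 * Equiv.swap 2 3) (c_plane (h.perm _ _) ?_ ?_ ?_) <;>
      simp [Equiv.swap_apply_def, h0, k, l]
  have hx : p 1 0 ≠ 0 ∨ p 1 1 ≠ 0 := by
    by_contra hcon
    push Not at hcon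
    rcases cN_cases (h.N 1) with c | c | c | c | c | c | c <;> simp_all
  obtain ⟨α, β, c, hc, h2, hF⟩ := c_repar h h0 hx
  have e0 := h2 0
  have e1 := h2 1
  have e2 := h2 2
  have e3 := h2 3
  obtain ⟨r1, hr1⟩ := c_M (h.N 1) k.1 k.2
  obtain ⟨r2, hr2⟩ := c_M' (h.N 2) l.1 l.2
  have hv := cS_val.2.1 h0
  rw [h0.1] at e0
  rw [h0.2.1] at e1
  by_cases ha : α = 0
  · subst ha
    have hb : β ≠ 0 := by
      rintro rfl
      rcases cN_cases (h.N 2) with c | c | c | c | c | c | c <;> simp_all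
    have hxy : p 1 1 = p 1 0 := by
      apply mul_left_cancel₀ hb
      linear_combination -e1 - e2 + l.2 - β * k.1
    exact c_caseC h h0 ⟨hxy, k.1, by rw [k.2, hxy]⟩
  · have hw : p 0 3 = - p 0 2 := by
      apply mul_left_cancel₀ ha
      linear_combination -e3 - e2 - e1 - e0 + l.1 + l.2 - β * k.1 - β * k.2
    exact ⟨p 0 2 * r1 * r2, by rw [hv, hr1, hr2, hw]; ring⟩

theorem c_finish' {K : Type*} [Field K] {p : Fin 3 → Fin 4 → K} (h : CGood p)
    (h0 : p 0 0 = 0 ∧ p 0 1 = 0 ∧ p 0 2 ≠ 0 ∧ p 0 3 ≠ 0)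
    (hq1 : (p 1 0 + p 1 2) * (p 1 1 + p 1 3) = 0)
    (hq2 : (p 1 0 + p 1 3) * (p 1 1 + p 1 2) = 0) : CSq p := by
  rcases c_bad (h.N 1) hq1 with k | k | k
  · exfalso; simp [k] at hq2
  · exfalso; simp [k] at hq2
  · have hxy : p 1 1 = p 1 0 := by
      have : (p 1 0 - p 1 1) ^ 2 = 0 := by rw [k.1, k.2] at hq2; linear_combination -hq2
      have := pow_eq_zero_iff (two_ne_zero) |>.1 this
      linear_combination -this
    exact c_caseC h h0 ⟨hxy, k.1, by rw [k.2, hxy]⟩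

theorem c_edge {K : Type*} [Field K] {p : Fin 3 → Fin 4 → K} (h : CGood p)
    (h0 : p 0 0 = 0 ∧ p 0 1 = 0 ∧ p 0 2 ≠ 0 ∧ p 0 3 ≠ 0) : CSq p := by
  by_cases A : ∀ i, (p i 0 + p i 2) * (p i 1 + p i 3) ≠ 0
  · refine CSq.of_perm 1 (Equiv.swap 1 2) (c_core (h.perm _ _) fun i => ?_)
    simpa [Equiv.swap_apply_def] using A i
  by_cases B : ∀ i, (p i 0 + p i 3) * (p i 1 + p i 2) ≠ 0
  · refine CSq.of_perm 1 (Equiv.swap 1 3) (c_core (h.perm _ _) fun i => ?_)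
    have := B i
    simp [Equiv.swap_apply_def] at this ⊢
    rw [add_comm (p i 2)]
    exact this
  push Not at A B
  obtain ⟨i, hi⟩ := A
  obtain ⟨j, hj⟩ := B
  fin_cases i <;> fin_cases j
  any_goals (exfalso; simp [h0] at hi; done)
  any_goals (exfalso; simp [h0] at hj; done)
  · exact c_finish' h h0 hi hj
  · exact c_finish h h0 hi hj
  · refine CSq.of_perm (Equiv.swap 1 2) 1 (c_finish (h.perm _ _) ?_ ?_ ?_)
    · simpa [Equiv.swap_apply_def] using h0
    · simpa [Equiv.swap_apply_def] using hi
    · simpa [Equiv.swap_apply_def] using hj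
  · refine CSq.of_perm (Equiv.swap 1 2) 1 (c_finish' (h.perm _ _) ?_ ?_ ?_)
    · simpa [Equiv.swap_apply_def] using h0
    · simpa [Equiv.swap_apply_def] using hi
    · simpa [Equiv.swap_apply_def] using hj

theorem c_main {K : Type*} [Field K] {p : Fin 3 → Fin 4 → K} (h : CGood p) : CSq p := by
  by_cases A : ∀ i, p i 0 ≠ 0 ∧ p i 1 ≠ 0 ∧ p i 2 ≠ 0 ∧ p i 3 ≠ 0
  · exact c_generic h A
  rw [not_forall] at A
  obtain ⟨i, hi⟩ := A
  have key : ∃ σ : Equiv.Perm (Fin 4), p i (σ 0) = 0 ∧ p i (σ 1) = 0 ∧ p i (σ 2) ≠ 0 ∧ p i (σ 3) ≠ 0 := by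
    rcases cN_cases (h.N i) with c | c | c | c | c | c | c
    · exact absurd c hi
    · exact ⟨1, by simp [c]⟩
    · exact ⟨Equiv.swap 1 2, by simp [Equiv.swap_apply_def, c]⟩
    · exact ⟨Equiv.swap 1 3, by simp [Equiv.swap_apply_def, c]⟩
    · exact ⟨Equiv.swap 0 2, by simp [Equiv.swap_apply_def, c]⟩
    · exact ⟨Equiv.swap 0 3, by simp [Equiv.swap_apply_def, c]⟩
    · exact ⟨Equiv.swap 0 2 * Equiv.swap 1 3, by simp [Equiv.swap_apply_def, c]⟩
  obtain ⟨σ, hσ⟩ := key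
  refine CSq.of_perm (Equiv.swap 0 i) σ (c_edge (h.perm _ _) ?_)
  simpa using hσ

open Classical in
/-- Let `V ⊂ P³` be the Cayley cubic over a field `K`.  Consider a line,
spanned by linearly independent vectors `a` and `b`, that is not contained in `V` and whose
intersection cycle with `V` consists of the three `K`-rational points `p 0`, `p 1`, `p 2`
(counted with multiplicity), encoded by the factorization of the binary cubic form obtained
by restricting the Cayley form to the line into the three linear forms corresponding to the
parameters `(s i, t i)` of the points, with a nonzero constant `c`.  Assume all three points
are non-singular points of `V`.  Then each `p i` has either no vanishing coordinate or
exactly two of them, and `s(p 0)·s(p 1)·s(p 2)` is a perfect square in `K`. -/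
theorem cayley_s_product_is_square (K : Type*) [Field K]
    (a b : Fin 4 → K) (hab : LinearIndependent K ![a, b])
    (c : K) (hc : c ≠ 0) (s t : Fin 3 → K)
    (p : Fin 3 → Fin 4 → K)
    (hp : ∀ i, p i = s i • a + t i • b)
    (hpne : ∀ i, p i ≠ 0)
    (honV : ∀ i, cayleyF (p i) = 0)
    (hsmooth : ∀ i, cayleyGrad (p i) ≠ 0)
    (hfact : cayleyF (fun j => C (a j) * X 0 + C (b j) * X 1) =
      C c * ∏ i : Fin 3,
        (C (t i) * (X 0 : MvPolynomial (Fin 2) K) - C (s i) * X 1)) :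
    (∀ i, (∀ j, p i j ≠ 0) ∨ (Finset.univ.filter fun j => p i j = 0).card = 2) ∧
      ∃ r : K, cayleyS (p 0) * cayleyS (p 1) * cayleyS (p 2) = r ^ 2 := by
  have hN : ∀ i, CNs (p i) := fun i => cN_of_smooth (honV i) (hsmooth i)
  refine ⟨fun i => ?_, ?_⟩
  · rcases cN_cases (hN i) with c | c | c | c | c | c | c
    · left
      simpa [Fin.forall_fin_succ] using c
    all_goals
      right
      rw [Finset.card_filter, Fin.sum_univ_four]
      simp [c]
  · refine c_main ⟨a, b, c, s, t, hc, hp, fun X Y => ?_, hN⟩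
    have := congrArg (MvPolynomial.eval ![X, Y]) hfact
    simp only [cayleyF, map_add, map_mul, map_prod, map_sub, MvPolynomial.eval_C,
      MvPolynomial.eval_X, Matrix.cons_val_zero, Matrix.cons_val_one] at this
    rw [← this]
    simp only [cayleyF, Pi.add_apply, Pi.smul_apply, smul_eq_mul]
    ring
end

section
/- Let R be a commutative ring, k ∈ R, and let x, y, z, w, x′, y′, z′, w′ ∈ R satisfy yz + k·w² = 0 and y′z′ + k·w′² = 0. Then (xy)(x′y′)·k·((x′y − xy′)(x′z − xz′) + k·(x′w − xw′)²) = (k·x·x′·(yw′ − y′w))². In particular, over a field this product is a perfect square. -/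
theorem cone_square_identity (R : Type*) [CommRing R] (k : R)
    (x y z w x' y' z' w' : R)
    (h : y * z + k * w ^ 2 = 0) (h' : y' * z' + k * w' ^ 2 = 0) :
    (x * y) * (x' * y') * k *
        ((x' * y - x * y') * (x' * z - x * z') + k * (x' * w - x * w') ^ 2) =
      (k * x * x' * (y * w' - y' * w)) ^ 2 := by
  linear_combination (k * x * y * x' * y' * x' ^ 2 - k * x ^ 2 * x' ^ 2 * y' ^ 2) * h +
    (k * x * y * x' * y' * x ^ 2 - k * x ^ 2 * x' ^ 2 * y ^ 2) * h'
end

section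
/- The torsion subgroup of the quotient of ℤ⁷ by the subgroup generated by the vectors (2,−1,−1,−1,−1,−1,−1), (0,0,0,0,0,1,−1), (0,0,0,1,−1,0,0) and (0,1,−1,0,0,0,0) is isomorphic to ℤ/2ℤ. (This is the singularity type 4A₁.) -/
abbrev LL : Submodule ℤ (Fin 7 → ℤ) :=
  Submodule.span ℤ ({![2,-1,-1,-1,-1,-1,-1], ![0,0,0,0,0,1,-1], ![0,0,0,1,-1,0,0], ![0,1,-1,0,0,0,0]} : Set (Fin 7 → ℤ))

theorem mem_LL (v : Fin 7 → ℤ) : v ∈ LL ↔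
    v 0 + v 1 + v 2 = 0 ∧ v 0 + v 3 + v 4 = 0 ∧ v 0 + v 5 + v 6 = 0 ∧ v 0 % 2 = 0 := by
  simp only [LL, Submodule.mem_span_insert, Submodule.mem_span_singleton]
  constructor
  · rintro ⟨a, _, ⟨b, _, ⟨c, _, ⟨d, rfl⟩, rfl⟩, rfl⟩, rfl⟩
    simp
    omega
  · rintro ⟨h1, h2, h3, h4⟩
    refine ⟨v 0 / 2, _, ⟨v 5 + v 0 / 2, _, ⟨v 3 + v 0 / 2, _, ⟨v 1 + v 0 / 2, rfl⟩, rfl⟩, rfl⟩, ?_⟩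
    ext i
    fin_cases i <;> simp <;> omega

def fL : ((Fin 7 → ℤ) ⧸ LL) →ₗ[ℤ] ZMod 2 :=
  Submodule.liftQ LL ((Int.castAddHom (ZMod 2)).toIntLinearMap ∘ₗ LinearMap.proj 0) (by
    intro v hv
    have h := ((mem_LL v).1 hv).2.2.2
    simp only [LinearMap.mem_ker, LinearMap.comp_apply, LinearMap.proj_apply]
    exact (ZMod.intCast_zmod_eq_zero_iff_dvd _ 2).2 (by push_cast; omega))

theorem fL_mk (v : Fin 7 → ℤ) : fL (Submodule.Quotient.mk v) = ((v 0 : ℤ) : ZMod 2) := rfl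

theorem quotient_torsion_eq :
    Nonempty
      ((AddCommGroup.torsion
        ((Fin 7 → ℤ) ⧸ Submodule.span ℤ ({![2,-1,-1,-1,-1,-1,-1], ![0,0,0,0,0,1,-1], ![0,0,0,1,-1,0,0], ![0,1,-1,0,0,0,0]} : Set (Fin 7 → ℤ)))) ≃+
        ZMod 2) := by
  refine ⟨AddEquiv.ofBijective (fL.toAddMonoidHom.comp
    (AddSubgroup.subtype (AddCommGroup.torsion ((Fin 7 → ℤ) ⧸ LL)))) ⟨?_, ?_⟩⟩
  · rw [injective_iff_map_eq_zero]
    rintro ⟨x, hx⟩ h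
    obtain ⟨v, rfl⟩ := Submodule.Quotient.mk_surjective _ x
    replace h : fL (Submodule.Quotient.mk v) = 0 := h
    rw [fL_mk] at h
    have h0 := (ZMod.intCast_zmod_eq_zero_iff_dvd _ 2).1 h
    push_cast at h0
    obtain ⟨n, hn, hnv⟩ := isOfFinAddOrder_iff_nsmul_eq_zero.1 hx
    rw [← Submodule.Quotient.mk_smul, Submodule.Quotient.mk_eq_zero, mem_LL] at hnv
    simp only [Pi.smul_apply, nsmul_eq_mul, ← mul_add] at hnv
    have hn' : (n : ℤ) ≠ 0 := by omega
    obtain ⟨h1, h2, h3, -⟩ := hnv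
    apply Subtype.ext
    refine (Submodule.Quotient.mk_eq_zero _).2 ((mem_LL v).2 ⟨?_, ?_, ?_, by omega⟩)
    · exact (mul_eq_zero.1 h1).resolve_left hn'
    · exact (mul_eq_zero.1 h2).resolve_left hn'
    · exact (mul_eq_zero.1 h3).resolve_left hn'
  · have ht : (Submodule.Quotient.mk ![1,-1,0,-1,0,-1,0] : (Fin 7 → ℤ) ⧸ LL) ∈
        AddCommGroup.torsion ((Fin 7 → ℤ) ⧸ LL) := by
      refine isOfFinAddOrder_iff_nsmul_eq_zero.2 ⟨2, by norm_num, ?_⟩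
      rw [← Submodule.Quotient.mk_smul, Submodule.Quotient.mk_eq_zero, mem_LL]
      simp
    intro y
    have hy : y = 0 ∨ y = 1 := by revert y; decide
    rcases hy with rfl | rfl
    · exact ⟨0, map_zero _⟩
    · refine ⟨⟨_, ht⟩, ?_⟩
      change fL (Submodule.Quotient.mk _) = 1
      rw [fL_mk]
      simp
end
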